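/- For every GNN A and every K^# formula φ, there exist K^# formulas χ₁, χ₂, χ₃, χ₄ such that: ⟦A⟧ = ⟦φ⟧ if and only if χ₁ is unsatisfiable; ⟦A⟧ ⊆ ⟦φ⟧ if and only if χ₂ is unsatisfiable; ⟦φ⟧ ⊆ ⟦A⟧ if and only if χ₃ is unsatisfiable; and ⟦φ⟧ ∩ ⟦A⟧ ≠ ∅ if and only if χ₄ is satisfiable. -/

import Mathlib

/-- A labeled directed graph: finite vertex set, directed edges, and a
labeling of each vertex by a valuation over atomic propositions (ℕ). -/
structure PGraph where
  V : Type
  fintV : Fintype V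
  decV : DecidableEq V
  E : V → V → Bool
  label : V → ℕ → Bool

attribute [instance] PGraph.fintV PGraph.decV

mutual
/-- Formulas of the logic K^#. -/
inductive KForm : Type where
  | atom : ℕ → KForm
  | neg : KForm → KForm
  | or : KForm → KForm → KForm
  | geq : KExpr → KForm          -- ξ ≥ 0
/-- Arithmetic expressions of the logic K^#. -/
inductive KExpr : Type where
  | const : ℤ → KExpr
  | one : KForm → KExpr          -- 1_φ
  | count : KForm → KExpr        -- #φ
  | add : KExpr → KExpr → KExpr
  | mul : ℤ → KExpr → KExpr      -- c × ξ
end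

mutual
/-- Truth of a K^# formula at a pointed graph. -/
def KForm.eval (G : PGraph) : G.V → KForm → Bool
  | u, .atom p => G.label u p
  | u, .neg φ => !(KForm.eval G u φ)
  | u, .or φ ψ => KForm.eval G u φ || KForm.eval G u ψ
  | u, .geq ξ => decide (0 ≤ KExpr.eval G u ξ)
/-- Value of a K^# arithmetic expression at a pointed graph. -/
def KExpr.eval (G : PGraph) : G.V → KExpr → ℤ
  | _, .const c => c
  | u, .one φ => if KForm.eval G u φ then 1 else 0
  | u, .count φ =>
      ((Finset.univ.filter (fun v => G.E u v && KForm.eval G v φ = true)).card : ℤ)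
  | u, .add ξ ξ' => KExpr.eval G u ξ + KExpr.eval G u ξ'
  | u, .mul c ξ => c * KExpr.eval G u ξ
end

def KForm.satisfiable (φ : KForm) : Prop := ∃ (G : PGraph) (u : G.V), φ.eval G u = true

def KForm.valid (φ : KForm) : Prop := ∀ (G : PGraph) (u : G.V), φ.eval G u = true

/-- Truncated ReLU. -/
noncomputable def trunc (x : ℝ) : ℝ := max 0 (min 1 x)

/-- A GNN: `L` layers; layer `t` (for `0 ≤ t < L`) has integer matrices
`C t`, `A t` and integer bias `b t`, mapping states of dimension `dim t` to
states of dimension `dim (t+1)`; `a` gives the integer coefficients of the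
final linear classification function. The initial dimension `dim 0` is the
number of atomic propositions used. -/
structure GNN where
  L : ℕ
  dim : ℕ → ℕ
  C : (t : ℕ) → Matrix (Fin (dim t)) (Fin (dim (t + 1))) ℤ
  A : (t : ℕ) → Matrix (Fin (dim t)) (Fin (dim (t + 1))) ℤ
  b : (t : ℕ) → Fin (dim (t + 1)) → ℤ
  a : Fin (dim L) → ℤ

/-- The state of a GNN on a graph after `t` layers. -/
noncomputable def GNN.state (N : GNN) (G : PGraph) : (t : ℕ) → G.V → Fin (N.dim t) → ℝ
  | 0, u, i => if G.label u i then 1 else 0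
  | t + 1, u, j => trunc (
      (∑ i, N.state G t u i * (N.C t i j : ℝ)) +
      (∑ i, (∑ v ∈ Finset.univ.filter (fun v => G.E u v = true), N.state G t v i)
            * (N.A t i j : ℝ)) +
      (N.b t j : ℝ))

/-- The GNN accepts a pointed graph iff `cls(x_L(u)) = 1`, i.e. `Σ a_i x_i ≥ 1`. -/
noncomputable def GNN.accepts (N : GNN) (G : PGraph) (u : G.V) : Prop :=
  1 ≤ ∑ i, (N.a i : ℝ) * N.state G N.L u i

mutual
/-- Modal depth of a K^# formula. -/
def KForm.md : KForm → ℕ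
  | .atom _ => 0
  | .neg φ => φ.md
  | .or φ ψ => max φ.md ψ.md
  | .geq ξ => ξ.md
/-- Modal depth of a K^# expression. -/
def KExpr.md : KExpr → ℕ
  | .const _ => 0
  | .one φ => φ.md
  | .count φ => φ.md + 1
  | .add ξ ξ' => max ξ.md ξ'.md
  | .mul _ ξ => ξ.md
end

mutual
/-- Size (number of syntax-tree nodes) of a K^# formula. -/
def KForm.size : KForm → ℕ
  | .atom _ => 1
  | .neg φ => φ.size + 1
  | .or φ ψ => φ.size + ψ.size + 1
  | .geq ξ => ξ.size + 1
/-- Size (number of syntax-tree nodes) of a K^# expression. -/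
def KExpr.size : KExpr → ℕ
  | .const _ => 1
  | .one φ => φ.size + 1
  | .count φ => φ.size + 1
  | .add ξ ξ' => ξ.size + ξ'.size + 1
  | .mul _ ξ => ξ.size + 2
end

mutual
/-- Atomic propositions occurring in a K^# formula. -/
def KForm.atoms : KForm → Finset ℕ
  | .atom p => {p}
  | .neg φ => φ.atoms
  | .or φ ψ => φ.atoms ∪ ψ.atoms
  | .geq ξ => ξ.atoms
/-- Atomic propositions occurring in a K^# expression. -/
def KExpr.atoms : KExpr → Finset ℕ
  | .const _ => ∅
  | .one φ => φ.atoms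
  | .count φ => φ.atoms
  | .add ξ ξ' => ξ.atoms ∪ ξ'.atoms
  | .mul _ ξ => ξ.atoms
end

/-- Conjunction, defined from ¬ and ∨. -/
def KForm.andF (φ ψ : KForm) : KForm := .neg (.or (.neg φ) (.neg ψ))

/-- Implication, defined from ¬ and ∨. -/
def KForm.impF (φ ψ : KForm) : KForm := .or (.neg φ) ψ

/-- Bi-implication, defined from ¬ and ∨. -/
def KForm.iffF (φ ψ : KForm) : KForm := KForm.andF (φ.impF ψ) (ψ.impF φ)

/-- The modality □φ, abbreviating `0 − #(¬φ) ≥ 0`. -/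
def KForm.box (φ : KForm) : KForm :=
  .geq (.add (.const 0) (.mul (-1) (.count (.neg φ))))

/-- `i`-fold iteration □^i of □. -/
def KForm.boxIter : ℕ → KForm → KForm
  | 0, φ => φ
  | i + 1, φ => KForm.box (KForm.boxIter i φ)

/-- The modality `□^{≤m} φ := ⋀_{0 ≤ i ≤ m} □^i φ`. -/
def KForm.boxUpTo : ℕ → KForm → KForm
  | 0, φ => φ
  | m + 1, φ => KForm.andF (KForm.boxUpTo m φ) (KForm.boxIter (m + 1) φ)

/-- `#ψ = k`, abbreviating `(#ψ − k ≥ 0) ∧ (k − #ψ ≥ 0)`. -/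
def KForm.countEq (ψ : KForm) (k : ℤ) : KForm :=
  KForm.andF (.geq (.add (.count ψ) (.const (-k))))
             (.geq (.add (.const k) (.mul (-1) (.count ψ))))

/-- The sum of a finite family of expressions. -/
def KExpr.sum {n : ℕ} (f : Fin n → KExpr) : KExpr :=
  (List.ofFn f).foldr .add (.const 0)

theorem KExpr.eval_sum (G : PGraph) (u : G.V) {n : ℕ} (f : Fin n → KExpr) :
    (KExpr.sum f).eval G u = ∑ i, (f i).eval G u := by
  induction n with
  | zero => simp [KExpr.sum, KExpr.eval]
  | succ n ih =>
    have h := ih (fun i => f i.succ)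
    simp only [KExpr.sum] at h
    rw [Fin.sum_univ_succ, KExpr.sum, List.ofFn_succ, List.foldr_cons, KExpr.eval, h]

/-- A formula expressing that the `j`-th coordinate of the state after `t` layers is `1`. -/
def GNN.stateForm (N : GNN) : (t : ℕ) → Fin (N.dim t) → KForm
  | 0, i => .atom i
  | t + 1, j => .geq (.add (.add
      (KExpr.sum fun i => .mul (N.C t i j) (.one (N.stateForm t i)))
      (KExpr.sum fun i => .mul (N.A t i j) (.count (N.stateForm t i))))
      (.const (N.b t j - 1)))

/-- A formula expressing acceptance by a GNN. -/
def GNN.toForm (N : GNN) : KForm :=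
  .geq (.add (KExpr.sum fun i => .mul (N.a i) (.one (N.stateForm N.L i))) (.const (-1)))

theorem trunc_intCast (z : ℤ) : trunc (z : ℝ) = if 1 ≤ z then 1 else 0 := by
  unfold trunc
  split_ifs with h
  · have h' : (1 : ℝ) ≤ z := by exact_mod_cast h
    simp [min_eq_left h']
  · have h' : (z : ℝ) ≤ 0 := by exact_mod_cast (by omega : z ≤ 0)
    exact max_eq_left ((min_le_right _ _).trans h')

theorem GNN.state_eq_eval_stateForm (N : GNN) (G : PGraph) (t : ℕ) (u : G.V)
    (j : Fin (N.dim t)) :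
    N.state G t u j = if (N.stateForm t j).eval G u then 1 else 0 := by
  induction t generalizing u with
  | zero => simp [GNN.state, GNN.stateForm, KForm.eval]
  | succ t ih =>
    have hz : (∑ i, N.state G t u i * (N.C t i j : ℝ)) +
        (∑ i, (∑ v ∈ Finset.univ.filter (fun v => G.E u v = true), N.state G t v i)
          * (N.A t i j : ℝ)) + (N.b t j : ℝ) =
        (((∑ i, N.C t i j * (KExpr.one (N.stateForm t i)).eval G u) +
          (∑ i, N.A t i j * (KExpr.count (N.stateForm t i)).eval G u) + N.b t j : ℤ) : ℝ) := by
      push_cast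
      congr 2
      · refine Finset.sum_congr rfl fun i _ => ?_
        rw [ih, mul_comm, KExpr.eval]
        push_cast
        rfl
      · refine Finset.sum_congr rfl fun i _ => ?_
        rw [mul_comm, KExpr.eval]
        simp only [ih, Finset.sum_boole, Finset.filter_filter, Bool.and_eq_true,
          decide_eq_true_eq, Int.cast_natCast]
    rw [GNN.state, hz, trunc_intCast, GNN.stateForm, KForm.eval]
    simp only [KExpr.eval, KExpr.eval_sum, decide_eq_true_eq]
    congr 1
    rw [eq_iff_iff]
    omega

theorem GNN.accepts_iff_eval_toForm (N : GNN) (G : PGraph) (u : G.V) :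
    N.accepts G u ↔ N.toForm.eval G u = true := by
  have hz : (∑ i, (N.a i : ℝ) * N.state G N.L u i) =
      ((∑ i, N.a i * (KExpr.one (N.stateForm N.L i)).eval G u : ℤ) : ℝ) := by
    push_cast
    refine Finset.sum_congr rfl fun i _ => ?_
    rw [N.state_eq_eval_stateForm, KExpr.eval]
    push_cast
    rfl
  rw [GNN.accepts, hz, GNN.toForm, KForm.eval, ← Int.cast_one, Int.cast_le]
  simp only [KExpr.eval, KExpr.eval_sum, decide_eq_true_eq]
  omega

theorem KForm.eval_andF (G : PGraph) (u : G.V) (φ ψ : KForm) :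
    (φ.andF ψ).eval G u = (φ.eval G u && ψ.eval G u) := by
  simp [KForm.andF, KForm.eval]

theorem KForm.eval_impF (G : PGraph) (u : G.V) (φ ψ : KForm) :
    (φ.impF ψ).eval G u = (!φ.eval G u || ψ.eval G u) := by
  simp [KForm.impF, KForm.eval]

theorem KForm.eval_iffF (G : PGraph) (u : G.V) (φ ψ : KForm) :
    (φ.iffF ψ).eval G u = true ↔ (φ.eval G u = true ↔ ψ.eval G u = true) := by
  rw [KForm.iffF, KForm.eval_andF, KForm.eval_impF, KForm.eval_impF]
  cases φ.eval G u <;> cases ψ.eval G u <;> simp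

theorem KForm.not_satisfiable_neg (φ : KForm) :
    ¬ (KForm.neg φ).satisfiable ↔ ∀ (G : PGraph) (u : G.V), φ.eval G u = true := by
  simp [KForm.satisfiable, KForm.eval]

/-- For every GNN A and K^# formula φ there are K^# formulas
χ₁–χ₄ reducing the problems ⟦A⟧=⟦φ⟧, ⟦A⟧⊆⟦φ⟧, ⟦φ⟧⊆⟦A⟧, ⟦φ⟧∩⟦A⟧≠∅ to
(un)satisfiability. -/
theorem GNN_problems_reduce_to_satisfiability (N : GNN) (φ : KForm) :
    ∃ χ₁ χ₂ χ₃ χ₄ : KForm,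
      ((∀ (G : PGraph) (u : G.V), N.accepts G u ↔ φ.eval G u = true) ↔
        ¬ χ₁.satisfiable) ∧
      ((∀ (G : PGraph) (u : G.V), N.accepts G u → φ.eval G u = true) ↔
        ¬ χ₂.satisfiable) ∧
      ((∀ (G : PGraph) (u : G.V), φ.eval G u = true → N.accepts G u) ↔
        ¬ χ₃.satisfiable) ∧
      ((∃ (G : PGraph) (u : G.V), φ.eval G u = true ∧ N.accepts G u) ↔
        χ₄.satisfiable) := by
  refine ⟨.neg (N.toForm.iffF φ), .neg (N.toForm.impF φ), .neg (φ.impF N.toForm),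
    φ.andF N.toForm, ?_, ?_, ?_, ?_⟩
  · simp only [KForm.not_satisfiable_neg, KForm.eval_iffF, N.accepts_iff_eval_toForm]
  · simp [KForm.not_satisfiable_neg, KForm.eval_impF, N.accepts_iff_eval_toForm,
      imp_iff_not_or]
  · simp [KForm.not_satisfiable_neg, KForm.eval_impF, N.accepts_iff_eval_toForm,
      imp_iff_not_or]
  · simp [KForm.satisfiable, KForm.eval_andF, N.accepts_iff_eval_toForm]
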